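/- There is no 3-(11,5,2) block design. That is, there is no set D of 5-element subsets of an 11-element set V such that every 3-element subset of V is contained in exactly 2 members of D. -/

import Mathlib

/-- Double counting of the pairs `(x, B)` with `x ∉ T` and `insert x T ⊆ B`: a design on `(t + 1)`-sets is
also a design on `t`-sets. -/
theorem card_filter_superset_mul {V : Type*} [Fintype V] [DecidableEq V] {D : Finset (Finset V)}
    {k t l : ℕ} (hk : ∀ B ∈ D, B.card = k)
    (hD : ∀ T : Finset V, T.card = t + 1 → (D.filter (fun B => T ⊆ B)).card = l)
    {T : Finset V} (hT : T.card = t) :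
    (D.filter (fun B => T ⊆ B)).card * (k - t) = (Fintype.card V - t) * l := by
  have hcount := Finset.sum_card_bipartiteAbove_eq_sum_card_bipartiteBelow
    (s := Tᶜ) (t := D.filter (fun B => T ⊆ B)) (fun x B => x ∈ B)
  have hleft : ∀ x ∈ Tᶜ, (Finset.bipartiteAbove (fun x B => x ∈ B)
      (D.filter (fun B => T ⊆ B)) x).card = l := by
    intro x hx
    rw [← hD (insert x T) (by rw [Finset.card_insert_of_notMem (by simpa using hx), hT])]
    congr 1
    ext B
    simp only [Finset.mem_bipartiteAbove, Finset.mem_filter, Finset.insert_subset_iff]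
    tauto
  have hright : ∀ B ∈ D.filter (fun B => T ⊆ B),
      (Finset.bipartiteBelow (fun x B => x ∈ B) Tᶜ B).card = k - t := by
    intro B hB
    rw [Finset.mem_filter] at hB
    rw [← hk B hB.1, ← hT, ← Finset.card_sdiff_of_subset hB.2]
    congr 1
    ext x
    simp only [Finset.mem_bipartiteBelow, Finset.mem_compl, Finset.mem_sdiff]
    tauto
  rw [Finset.sum_congr rfl hleft, Finset.sum_congr rfl hright] at hcount
  simpa [Finset.card_compl, hT] using hcount.symm

/-- Double counting of the pairs `(T, B)` with `T` a `t`-subset of both `S` and the block `B`. -/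
theorem sum_choose_card_inter {V : Type*} [DecidableEq V] {D : Finset (Finset V)} {t l : ℕ}
    (hD : ∀ T : Finset V, T.card = t → (D.filter (fun B => T ⊆ B)).card = l) (S : Finset V) :
    ∑ B ∈ D, (S ∩ B).card.choose t = S.card.choose t * l := by
  have hcount := Finset.sum_card_bipartiteAbove_eq_sum_card_bipartiteBelow
    (s := S.powersetCard t) (t := D) (fun T B => T ⊆ B)
  have hleft : ∀ T ∈ S.powersetCard t,
      (Finset.bipartiteAbove (fun T B => T ⊆ B) D T).card = l :=
    fun T hT => hD T (Finset.mem_powersetCard.mp hT).2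
  have hright : ∀ B ∈ D, (Finset.bipartiteBelow (fun T B => T ⊆ B) (S.powersetCard t) B).card =
      (S ∩ B).card.choose t := by
    intro B _
    rw [← Finset.card_powersetCard]
    congr 1
    ext T
    simp only [Finset.mem_bipartiteBelow, Finset.mem_powersetCard, Finset.subset_inter_iff]
    tauto
  rw [Finset.sum_congr rfl hleft, Finset.sum_congr rfl hright] at hcount
  simpa using hcount.symm

/-- In a `3-(11,5,2)` design no two blocks meet in four points and every block is disjoint from
exactly two others. -/
theorem intersection_numbers_3_11_5_2 {V : Type*} [DecidableEq V] {D : Finset (Finset V)}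
    (hk : ∀ B ∈ D, B.card = 5)
    (h0 : ∀ T : Finset V, T.card = 0 → (D.filter (fun B => T ⊆ B)).card = 33)
    (h1 : ∀ T : Finset V, T.card = 1 → (D.filter (fun B => T ⊆ B)).card = 15)
    (h2 : ∀ T : Finset V, T.card = 2 → (D.filter (fun B => T ⊆ B)).card = 6)
    (h3 : ∀ T : Finset V, T.card = 3 → (D.filter (fun B => T ⊆ B)).card = 2)
    {B : Finset V} (hB : B ∈ D) :
    (D.filter (fun C => (B ∩ C).card = 4)).card = 0 ∧
      (D.filter (fun C => (B ∩ C).card = 0)).card = 2 := by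
  have hfive : D.filter (fun C => (B ∩ C).card = 5) = {B} := by
    ext C
    simp only [Finset.mem_filter, Finset.mem_singleton]
    constructor
    · rintro ⟨hC, hBC⟩
      have hl := Finset.eq_of_subset_of_card_le (Finset.inter_subset_left (s₁ := B) (s₂ := C))
        (by rw [hBC, hk B hB])
      have hr := Finset.eq_of_subset_of_card_le (Finset.inter_subset_right (s₁ := B) (s₂ := C))
        (by rw [hBC, hk C hC])
      exact hr.symm.trans hl
    · rintro rfl
      simp [hB, hk]
  have hfib : ∀ f : ℕ → ℕ, ∑ C ∈ D, f (B ∩ C).card =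
      ∑ i ∈ Finset.range 6, (D.filter (fun C => (B ∩ C).card = i)).card * f i := by
    intro f
    rw [← Finset.sum_fiberwise_of_maps_to' (g := fun C => (B ∩ C).card) (t := Finset.range 6)]
    · simp
    · intro C _
      have := Finset.card_le_card (Finset.inter_subset_left (s₁ := B) (s₂ := C))
      rw [hk B hB] at this
      exact Finset.mem_range.mpr (by omega)
  have e0 := sum_choose_card_inter h0 B
  have e1 := sum_choose_card_inter h1 B
  have e2 := sum_choose_card_inter h2 B
  have e3 := sum_choose_card_inter h3 B
  rw [hfib (fun n => n.choose _), hk B hB] at e0 e1 e2 e3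
  generalize hm : (fun i => (D.filter (fun C => (B ∩ C).card = i)).card) = m
  have hmi : ∀ i, (D.filter (fun C => (B ∩ C).card = i)).card = m i := fun i => congrFun hm i
  have hmfive : m 5 = 1 := by rw [← hmi, hfive, Finset.card_singleton]
  simp only [Finset.sum_range_succ, Finset.sum_range_zero, hmi] at e0 e1 e2 e3 ⊢
  norm_num [Nat.choose] at e0 e1 e2 e3
  omega


/-- There is no `3-(11,5,2)` block design: there is no set `D` of `5`-element
subsets of an `11`-element set `V` such that every `3`-element subset of `V` is
contained in exactly `2` members of `D`. -/
theorem no_design_3_11_5_2 (V : Type*) [Fintype V] [DecidableEq V]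
    (hV : Fintype.card V = 11) (D : Finset (Finset V))
    (hblocks : ∀ B ∈ D, B.card = 5)
    (hdesign : ∀ T : Finset V, T.card = 3 →
      (D.filter (fun B => T ⊆ B)).card = 2) :
    False := by
  have h2 : ∀ T : Finset V, T.card = 2 → (D.filter (fun B => T ⊆ B)).card = 6 := by
    intro T hT
    have := card_filter_superset_mul hblocks hdesign hT
    omega
  have h1 : ∀ T : Finset V, T.card = 1 → (D.filter (fun B => T ⊆ B)).card = 15 := by
    intro T hT
    have := card_filter_superset_mul hblocks h2 hT
    omega
  have h0 : ∀ T : Finset V, T.card = 0 → (D.filter (fun B => T ⊆ B)).card = 33 := by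
    intro T hT
    have := card_filter_superset_mul hblocks h1 hT
    omega
  have hnum := fun {B} => intersection_numbers_3_11_5_2 (B := B) hblocks h0 h1 h2 hdesign
  obtain ⟨B, hB⟩ : D.Nonempty := by
    rw [← Finset.card_pos]
    have := h0 ∅ rfl
    simp only [Finset.empty_subset, Finset.filter_true] at this
    omega
  obtain ⟨C, C', hne, hCC'⟩ := Finset.card_eq_two.mp (hnum hB).2
  have hC : C ∈ D.filter (fun C => (B ∩ C).card = 0) := by rw [hCC']; simp
  have hC' : C' ∈ D.filter (fun C => (B ∩ C).card = 0) := by rw [hCC']; simp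
  simp only [Finset.mem_filter, Finset.card_eq_zero] at hC hC'
  have hfour : (C ∩ C').card ≠ 4 := fun h => by
    have hempty := Finset.card_eq_zero.mp (hnum hC.1).1
    exact Finset.notMem_empty C' (hempty ▸ Finset.mem_filter.mpr ⟨hC'.1, h⟩)
  have hdisj : Disjoint B (C ∪ C') := by
    rw [Finset.disjoint_iff_inter_eq_empty, Finset.inter_union_distrib_left, hC.2, hC'.2,
      Finset.empty_union]
  have hle := Finset.card_le_univ (B ∪ (C ∪ C'))
  rw [Finset.card_union_of_disjoint hdisj, hV, hblocks B hB] at hle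
  have hadd := Finset.card_union_add_card_inter C C'
  have hCcard := hblocks C hC.1
  have hCcard' := hblocks C' hC'.1
  have hl := Finset.eq_of_subset_of_card_le (Finset.inter_subset_left (s₁ := C) (s₂ := C'))
    (by omega)
  have hr := Finset.eq_of_subset_of_card_le (Finset.inter_subset_right (s₁ := C) (s₂ := C'))
    (by omega)
  exact hne (hl.symm.trans hr)
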